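/- arXiv:1810.01504 — 2 statements merged into one kernel-verified Lean document; each statement's English description precedes it below -/
import Mathlib

section
/- Let S ⊆ ℝ³ be the set of points (x, y, z) satisfying all of the following: x ≥ 0, y ≥ 0, z ≥ 3x, z ≥ 2y; (z < 3x + 1 ∨ z < 2y + 1); (y < 1 ∨ z < 3x + 2 ∨ z < 2y); (x < 1 ∨ y < 2 ∨ z < 3x + 1 ∨ z < 2y); (x < 2 ∨ y < 3 ∨ z < 3x ∨ z < 2y); (x < 1 ∨ y < 1 ∨ z < 3x ∨ z < 2y + 1); and (x < 1 ∨ z < 3x ∨ z < 2y + 3). Then the 3-dimensional Lebesgue measure (volume) of S equals 41/18. -/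
open MeasureTheory

/-- The Hilbert-Kunz polytope for B_R((x³),(x²)): points (x,y,z) ∈ ℝ³ satisfying the
    listed system of inequalities. -/
def S : Set (ℝ × ℝ × ℝ) :=
  {p | 0 ≤ p.1 ∧ 0 ≤ p.2.1 ∧ 3 * p.1 ≤ p.2.2 ∧ 2 * p.2.1 ≤ p.2.2 ∧
       (p.2.2 < 3 * p.1 + 1 ∨ p.2.2 < 2 * p.2.1 + 1) ∧
       (p.2.1 < 1 ∨ p.2.2 < 3 * p.1 + 2 ∨ p.2.2 < 2 * p.2.1) ∧
       (p.1 < 1 ∨ p.2.1 < 2 ∨ p.2.2 < 3 * p.1 + 1 ∨ p.2.2 < 2 * p.2.1) ∧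
       (p.1 < 2 ∨ p.2.1 < 3 ∨ p.2.2 < 3 * p.1 ∨ p.2.2 < 2 * p.2.1) ∧
       (p.1 < 1 ∨ p.2.1 < 1 ∨ p.2.2 < 3 * p.1 ∨ p.2.2 < 2 * p.2.1 + 1) ∧
       (p.1 < 1 ∨ p.2.2 < 3 * p.1 ∨ p.2.2 < 2 * p.2.1 + 3)}

/-- The points `(x, y, z)` with `a ≤ x < b`, `l₀ + l₁ x ≤ y < u₀ + u₁ x` and
`z` in the half-open interval of length `α + β x + γ y` starting at `max (3 x) (2 y)`. -/
def prism (a b l₀ l₁ u₀ u₁ α β γ : ℝ) : Set (ℝ × ℝ × ℝ) :=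
  {w | (a ≤ w.1 ∧ w.1 < b) ∧ (l₀ + l₁ * w.1 ≤ w.2.1 ∧ w.2.1 < u₀ + u₁ * w.1) ∧
    max (3 * w.1) (2 * w.2.1) ≤ w.2.2 ∧
    w.2.2 < max (3 * w.1) (2 * w.2.1) + (α + β * w.1 + γ * w.2.1)}

lemma measurableSet_prism (a b l₀ l₁ u₀ u₁ α β γ : ℝ) :
    MeasurableSet (prism a b l₀ l₁ u₀ u₁ α β γ) := by
  unfold prism
  measurability

lemma setLIntegral_Ico_ofReal_quadratic {a b c₀ c₁ c₂ : ℝ} (hab : a ≤ b)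
    (h : ∀ t, a ≤ t → t < b → 0 ≤ c₀ + c₁ * t + c₂ * t ^ 2) :
    ∫⁻ t in Set.Ico a b, ENNReal.ofReal (c₀ + c₁ * t + c₂ * t ^ 2) =
      ENNReal.ofReal (c₀ * (b - a) + c₁ * (b ^ 2 - a ^ 2) / 2 + c₂ * (b ^ 3 - a ^ 3) / 3) := by
  have hc : Continuous fun t : ℝ => c₀ + c₁ * t + c₂ * t ^ 2 := by fun_prop
  rw [← ofReal_integral_eq_lintegral_ofReal
    (hc.continuousOn.integrableOn_Icc.mono_set Set.Ico_subset_Icc_self)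
    ((ae_restrict_iff' measurableSet_Ico).2 (.of_forall fun t ht => h t ht.1 ht.2)),
    integral_Ico_eq_integral_Ioc, ← intervalIntegral.integral_of_le hab,
    intervalIntegral.integral_eq_sub_of_hasDerivAt
      (f := fun t => c₀ * t + c₁ * t ^ 2 / 2 + c₂ * t ^ 3 / 3) _ (hc.intervalIntegrable a b)]
  · congr 1
    ring
  · intro t _
    have h₁ := (hasDerivAt_id t).const_mul c₀
    have h₂ := ((hasDerivAt_pow 2 t).const_mul c₁).div_const 2
    have h₃ := ((hasDerivAt_pow 3 t).const_mul c₂).div_const 3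
    refine ((h₁.add h₂).add h₃).congr_deriv ?_
    norm_num
    ring

lemma volume_prism {a b l₀ l₁ u₀ u₁ α β γ : ℝ} (hab : a ≤ b)
    (hlu : ∀ x, a ≤ x → x < b → l₀ + l₁ * x ≤ u₀ + u₁ * x)
    (hd : ∀ x y, a ≤ x → x < b → l₀ + l₁ * x ≤ y → y < u₀ + u₁ * x → 0 ≤ α + β * x + γ * y) :
    volume (prism a b l₀ l₁ u₀ u₁ α β γ) = ENNReal.ofReal
      ((α * (u₀ - l₀) + γ * (u₀ ^ 2 - l₀ ^ 2) / 2) * (b - a) +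
        (α * (u₁ - l₁) + β * (u₀ - l₀) + γ * (u₀ * u₁ - l₀ * l₁)) * (b ^ 2 - a ^ 2) / 2 +
        (β * (u₁ - l₁) + γ * (u₁ ^ 2 - l₁ ^ 2) / 2) * (b ^ 3 - a ^ 3) / 3) := by
  have hm := measurableSet_prism a b l₀ l₁ u₀ u₁ α β γ
  have slice : ∀ x, volume (Prod.mk x ⁻¹' prism a b l₀ l₁ u₀ u₁ α β γ) =
      (Set.Ico a b).indicator (fun x => ∫⁻ y in Set.Ico (l₀ + l₁ * x) (u₀ + u₁ * x),
        ENNReal.ofReal ((α + β * x) + γ * y + 0 * y ^ 2)) x := by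
    intro x
    rw [Measure.volume_eq_prod, Measure.prod_apply (measurable_prodMk_left hm)]
    by_cases hx : x ∈ Set.Ico a b
    · rw [Set.indicator_of_mem hx, ← lintegral_indicator measurableSet_Ico]
      congr 1 with y
      by_cases hy : y ∈ Set.Ico (l₀ + l₁ * x) (u₀ + u₁ * x)
      · have : Prod.mk y ⁻¹' (Prod.mk x ⁻¹' prism a b l₀ l₁ u₀ u₁ α β γ) =
            Set.Ico (max (3 * x) (2 * y)) (max (3 * x) (2 * y) + (α + β * x + γ * y)) := by
          ext z
          exact ⟨fun h => h.2.2, fun h => ⟨hx, hy, h⟩⟩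
        rw [Set.indicator_of_mem hy, this, Real.volume_Ico]
        congr 1
        ring
      · have : Prod.mk y ⁻¹' (Prod.mk x ⁻¹' prism a b l₀ l₁ u₀ u₁ α β γ) = ∅ :=
          Set.eq_empty_of_forall_notMem fun z h => hy h.2.1
        rw [Set.indicator_of_notMem hy, this, measure_empty]
    · have : ∀ y, Prod.mk y ⁻¹' (Prod.mk x ⁻¹' prism a b l₀ l₁ u₀ u₁ α β γ) = ∅ :=
        fun y => Set.eq_empty_of_forall_notMem fun z h => hx h.1
      simp [Set.indicator_of_notMem hx, this]
  have inner : ∀ x ∈ Set.Ico a b, ∫⁻ y in Set.Ico (l₀ + l₁ * x) (u₀ + u₁ * x),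
      ENNReal.ofReal ((α + β * x) + γ * y + 0 * y ^ 2) = ENNReal.ofReal
        ((α + β * x) * ((u₀ + u₁ * x) - (l₀ + l₁ * x)) +
          γ * ((u₀ + u₁ * x) ^ 2 - (l₀ + l₁ * x) ^ 2) / 2) := by
    intro x hx
    rw [setLIntegral_Ico_ofReal_quadratic (hlu x hx.1 hx.2)]
    · simp
    · intro y h₁ h₂
      simpa using hd x y hx.1 hx.2 h₁ h₂
  rw [Measure.volume_eq_prod, Measure.prod_apply hm]
  simp_rw [slice]
  rw [lintegral_indicator measurableSet_Ico, setLIntegral_congr_fun measurableSet_Ico inner]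
  have expand : ∀ x, (α + β * x) * ((u₀ + u₁ * x) - (l₀ + l₁ * x)) +
      γ * ((u₀ + u₁ * x) ^ 2 - (l₀ + l₁ * x) ^ 2) / 2 =
      (α * (u₀ - l₀) + γ * (u₀ ^ 2 - l₀ ^ 2) / 2) +
        (α * (u₁ - l₁) + β * (u₀ - l₀) + γ * (u₀ * u₁ - l₀ * l₁)) * x +
        (β * (u₁ - l₁) + γ * (u₁ ^ 2 - l₁ ^ 2) / 2) * x ^ 2 := fun x => by ring
  simp_rw [expand]
  refine setLIntegral_Ico_ofReal_quadratic hab fun x h₁ h₂ => ?_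
  rw [← expand]
  have hlu' := hlu x h₁ h₂
  rcases hlu'.eq_or_lt with heq | hlt
  · simp [heq]
  -- The length is nonnegative at the midpoint of the fibre, hence so is its integral.
  have hmid := hd x ((l₀ + l₁ * x + (u₀ + u₁ * x)) / 2) h₁ h₂ (by linarith) (by linarith)
  nlinarith [mul_nonneg hmid (sub_nonneg.2 hlu')]

/-- A decomposition of `S` into prisms. -/
noncomputable def piece : Fin 15 → Set (ℝ × ℝ × ℝ) :=
  ![prism 0 1 0 0 1 0 1 0 0,
    prism 0 (1/3) 1 0 1 (3/2) 2 3 (-2),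
    prism (1/3) 1 1 0 (1/2) (3/2) 1 0 0,
    prism (1/3) 1 (1/2) (3/2) 1 (3/2) 2 3 (-2),
    prism 1 (4/3) (-3/2) (3/2) (-1) (3/2) 3 (-3) 2,
    prism 1 (4/3) (-1) (3/2) 1 0 1 0 0,
    prism (4/3) (5/3) (-3/2) (3/2) 1 0 3 (-3) 2,
    prism 1 (4/3) (-1/2) (3/2) 0 (3/2) 1 (-3) 2,
    prism 1 (4/3) 0 (3/2) 2 0 1 0 0,
    prism (4/3) (5/3) (-1/2) (3/2) 2 0 1 (-3) 2,
    prism 1 (4/3) 2 0 (1/2) (3/2) 1 3 (-2),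
    prism (4/3) 2 0 (3/2) (1/2) (3/2) 1 3 (-2),
    prism (4/3) (5/3) 2 0 0 (3/2) 1 (-3) 2,
    prism (5/3) 2 (-1/2) (3/2) 0 (3/2) 1 (-3) 2,
    prism 2 (7/3) (-1/2) (3/2) 3 0 1 (-3) 2]

lemma measurableSet_piece (i : Fin 15) : MeasurableSet (piece i) := by
  fin_cases i <;> exact measurableSet_prism ..

lemma pairwise_disjoint_piece : Pairwise (Function.onFun Disjoint piece) := by
  suffices h : ∀ i j, i < j → Disjoint (piece i) (piece j) from fun i j hij =>
    hij.lt_or_gt.elim (h i j) fun hji => (h j i hji).symm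
  intro i j hij
  rw [Set.disjoint_left]
  rintro ⟨x, y, z⟩ hi hj
  fin_cases i <;> fin_cases j <;> first
    | exact absurd hij (by decide)
    | (obtain ⟨⟨h₁, h₂⟩, ⟨h₃, h₄⟩, -⟩ := hi
       obtain ⟨⟨k₁, k₂⟩, ⟨k₃, k₄⟩, -⟩ := hj
       dsimp only at h₁ h₂ h₃ h₄ k₁ k₂ k₃ k₄
       linarith)

lemma piece_subset (i : Fin 15) : piece i ⊆ S := by
  rintro ⟨x, y, z⟩ hi
  fin_cases i <;>
  · obtain ⟨⟨h₁, h₂⟩, ⟨h₃, h₄⟩, h₅, h₆⟩ := hi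
    dsimp only at h₁ h₂ h₃ h₄ h₅ h₆
    simp only [S, Set.mem_ofPred_eq]
    rcases max_cases (3 * x) (2 * y) with ⟨h, h'⟩ | ⟨h, h'⟩ <;> rw [h] at h₅ h₆ <;> grind

lemma subset_iUnion_piece : S ⊆ ⋃ i, piece i := by
  rintro ⟨x, y, z⟩ h
  simp only [S, Set.mem_ofPred_eq] at h
  refine Set.mem_iUnion.2 ⟨
    if x < 1 then
      if y < 1 then 0
      else if x < 1 / 3 then 1
      else if y < 1 / 2 + 3 / 2 * x then 2 else 3
    else if y < 1 then
      if x < 4 / 3 then if y < -1 + 3 / 2 * x then 4 else 5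
      else 6
    else if y < 2 then
      if x < 4 / 3 then if y < 3 / 2 * x then 7 else 8
      else 9
    else if x < 4 / 3 then 10
    else if y < 3 / 2 * x then
      if x < 5 / 3 then 12 else if x < 2 then 13 else 14
    else 11, ?_⟩
  split_ifs <;>
  · refine ⟨⟨?_, ?_⟩, ⟨?_, ?_⟩, max_le h.2.2.1 h.2.2.2.1, ?_⟩ <;> dsimp only <;>
      rcases max_cases (3 * x) (2 * y) with ⟨hm, hm'⟩ | ⟨hm, hm'⟩ <;> grind

lemma iUnion_piece : ⋃ i, piece i = S :=
  (Set.iUnion_subset piece_subset).antisymm subset_iUnion_piece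

/-- The volume of the Hilbert-Kunz polytope of B_R((x³),(x²)) is 41/18. -/
theorem hk_volume : volume S = 41 / 18 := by
  rw [← iUnion_piece, measure_iUnion pairwise_disjoint_piece measurableSet_piece, tsum_fintype]
  simp only [piece, Fin.sum_univ_succ, Matrix.cons_val_zero, Matrix.cons_val_succ,
    Finset.univ_eq_empty, Finset.sum_empty, add_zero]
  repeat rw [volume_prism (by norm_num) (by intros; linarith) (by intros; linarith)]
  have htotal : (41 / 18 : ENNReal) = ENNReal.ofReal (41 / 18) := by
    rw [ENNReal.ofReal_div_of_pos (by norm_num), ENNReal.ofReal_ofNat, ENNReal.ofReal_ofNat]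
  rw [htotal]
  repeat rw [← ENNReal.ofReal_add]
  all_goals norm_num
end

section
/- Let T ⊆ ℝ³ be the set of points (x, y, z) satisfying 0 ≤ x ≤ 1, 0 ≤ y ≤ 1, 3x ≤ z < 1 + 3x, and 2y ≤ z < 1 + 2y. Then the 3-dimensional Lebesgue measure (volume) of T equals 11/36. -/
open MeasureTheory

/-- The F-signature polytope for B_R((x³),(x²)): points (x,y,z) ∈ ℝ³ with
    0 ≤ x ≤ 1, 0 ≤ y ≤ 1, 3x ≤ z < 1+3x, 2y ≤ z < 1+2y. -/
def T : Set (ℝ × ℝ × ℝ) :=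
  {p | 0 ≤ p.1 ∧ p.1 ≤ 1 ∧ 0 ≤ p.2.1 ∧ p.2.1 ≤ 1 ∧
       3 * p.1 ≤ p.2.2 ∧ p.2.2 < 1 + 3 * p.1 ∧
       2 * p.2.1 ≤ p.2.2 ∧ p.2.2 < 1 + 2 * p.2.1}

/-- The horizontal slice of `T` at height `z`. -/
def slice (z : ℝ) : Set (ℝ × ℝ) := {p | (p.1, p.2, z) ∈ T}

theorem measurableSet_T : MeasurableSet T := by
  unfold T
  simp only [measurableSet_setOfPred]
  measurability

theorem volume_T_eq_lintegral_slice : volume T = ∫⁻ z, volume (slice z) := by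
  have h := (volume_preserving_prodAssoc (α₁ := ℝ) (β₁ := ℝ) (γ₁ := ℝ)).measure_preimage
    measurableSet_T.nullMeasurableSet
  rw [← h, Measure.volume_eq_prod (ℝ × ℝ) ℝ, Measure.prod_apply_symm
    (MeasurableEquiv.prodAssoc.measurable measurableSet_T)]
  rfl

theorem slice_of_mem_Ico_zero_one {z : ℝ} (hz : z ∈ Set.Ico (0 : ℝ) 1) :
    slice z = Set.Icc 0 (z / 3) ×ˢ Set.Icc 0 (z / 2) := by
  obtain ⟨h0, h1⟩ := hz
  ext ⟨x, y⟩
  simp only [slice, T, Set.mem_ofPred_eq, Set.mem_prod, Set.mem_Icc]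
  constructor
  · rintro ⟨_, _, _, _, _, _, _, _⟩
    refine ⟨⟨?_, ?_⟩, ?_, ?_⟩ <;> linarith
  · rintro ⟨⟨_, _⟩, _, _⟩
    refine ⟨?_, ?_, ?_, ?_, ?_, ?_, ?_, ?_⟩ <;> linarith

theorem slice_of_mem_Ico_one_two {z : ℝ} (hz : z ∈ Set.Ico (1 : ℝ) 2) :
    slice z = Set.Ioc ((z - 1) / 3) (z / 3) ×ˢ Set.Ioc ((z - 1) / 2) (z / 2) := by
  obtain ⟨h0, h1⟩ := hz
  ext ⟨x, y⟩
  simp only [slice, T, Set.mem_ofPred_eq, Set.mem_prod, Set.mem_Ioc]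
  constructor
  · rintro ⟨_, _, _, _, _, _, _, _⟩
    refine ⟨⟨?_, ?_⟩, ?_, ?_⟩ <;> linarith
  · rintro ⟨⟨_, _⟩, _, _⟩
    refine ⟨?_, ?_, ?_, ?_, ?_, ?_, ?_, ?_⟩ <;> linarith

theorem slice_of_mem_Ico_two_three {z : ℝ} (hz : z ∈ Set.Ico (2 : ℝ) 3) :
    slice z = Set.Ioc ((z - 1) / 3) (z / 3) ×ˢ Set.Ioc ((z - 1) / 2) 1 := by
  obtain ⟨h0, h1⟩ := hz
  ext ⟨x, y⟩
  simp only [slice, T, Set.mem_ofPred_eq, Set.mem_prod, Set.mem_Ioc]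
  constructor
  · rintro ⟨_, _, _, _, _, _, _, _⟩
    refine ⟨⟨?_, ?_⟩, ?_, ?_⟩ <;> linarith
  · rintro ⟨⟨_, _⟩, _, _⟩
    refine ⟨?_, ?_, ?_, ?_, ?_, ?_, ?_, ?_⟩ <;> linarith

theorem slice_of_notMem_Ico {z : ℝ} (hz : z ∉ Set.Ico (0 : ℝ) 3) : slice z = ∅ := by
  ext ⟨x, y⟩
  simp only [slice, T, Set.mem_ofPred_eq, Set.mem_empty_iff_false, iff_false]
  rintro ⟨_, _, _, _, _, _, _, _⟩
  exact hz ⟨by linarith, by linarith⟩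

theorem setLIntegral_Ico_eq_ofReal_intervalIntegral {F : ℝ → ENNReal} {f : ℝ → ℝ} {a b : ℝ}
    (hab : a ≤ b) (hf : Continuous f) (hf0 : ∀ z ∈ Set.Ico a b, 0 ≤ f z)
    (hF : ∀ z ∈ Set.Ico a b, F z = ENNReal.ofReal (f z)) :
    ∫⁻ z in Set.Ico a b, F z = ENNReal.ofReal (∫ z in a..b, f z) := by
  rw [setLIntegral_congr_fun measurableSet_Ico hF, intervalIntegral.integral_of_le hab,
    ← integral_Ico_eq_integral_Ioc, ofReal_integral_eq_lintegral_ofReal]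
  · exact (hf.integrableOn_Icc).mono_set Set.Ico_subset_Icc_self
  · exact (ae_restrict_iff' measurableSet_Ico).2 (Filter.Eventually.of_forall hf0)

theorem lintegral_slice_Ico_zero_one :
    ∫⁻ z in Set.Ico (0 : ℝ) 1, volume (slice z) = ENNReal.ofReal (1 / 18) := by
  rw [setLIntegral_Ico_eq_ofReal_intervalIntegral (f := fun z => z ^ 2 / 6) zero_le_one
    (by fun_prop) (fun z _ => by positivity)]
  · congr 1
    rw [intervalIntegral.integral_div, integral_pow]
    norm_num
  · intro z hz
    rw [slice_of_mem_Ico_zero_one hz, Measure.volume_eq_prod, Measure.prod_prod,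
      Real.volume_Icc, Real.volume_Icc, ← ENNReal.ofReal_mul (by linarith [hz.1])]
    congr 1
    ring

theorem lintegral_slice_Ico_one_two :
    ∫⁻ z in Set.Ico (1 : ℝ) 2, volume (slice z) = ENNReal.ofReal (1 / 6) := by
  rw [setLIntegral_Ico_eq_ofReal_intervalIntegral (f := fun _ => 1 / 6) one_le_two
    (by fun_prop) (fun z _ => by positivity)]
  · congr 1
    rw [intervalIntegral.integral_const]
    norm_num
  · intro z hz
    rw [slice_of_mem_Ico_one_two hz, Measure.volume_eq_prod, Measure.prod_prod,
      Real.volume_Ioc, Real.volume_Ioc, ← ENNReal.ofReal_mul (by linarith [hz.1])]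
    congr 1
    ring

theorem lintegral_slice_Ico_two_three :
    ∫⁻ z in Set.Ico (2 : ℝ) 3, volume (slice z) = ENNReal.ofReal (1 / 12) := by
  rw [setLIntegral_Ico_eq_ofReal_intervalIntegral (f := fun z => (3 - z) / 6) (by norm_num)
    (by fun_prop) (fun z hz => by linarith [hz.2])]
  · congr 1
    rw [intervalIntegral.integral_div, intervalIntegral.integral_sub (by simp) (by simp),
      intervalIntegral.integral_const, integral_id]
    norm_num
  · intro z hz
    rw [slice_of_mem_Ico_two_three hz, Measure.volume_eq_prod, Measure.prod_prod,
      Real.volume_Ioc, Real.volume_Ioc, ← ENNReal.ofReal_mul (by linarith [hz.1])]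
    congr 1
    ring

/-- The volume of the F-signature polytope of B_R((x³),(x²)) is 11/36. -/
theorem fsig_volume : volume T = 11 / 36 := by
  have hsupp : Function.support (fun z => volume (slice z)) ⊆ Set.Ico (0 : ℝ) 3 := by
    intro z hz
    by_contra h
    exact hz (by simp [slice_of_notMem_Ico h])
  rw [volume_T_eq_lintegral_slice, ← setLIntegral_eq_of_support_subset hsupp,
    ← Set.Ico_union_Ico_eq_Ico (b := (2 : ℝ)) (by norm_num) (by norm_num),
    lintegral_union measurableSet_Ico Set.Ico_disjoint_Ico_same,
    ← Set.Ico_union_Ico_eq_Ico (b := (1 : ℝ)) (by norm_num) (by norm_num),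
    lintegral_union measurableSet_Ico Set.Ico_disjoint_Ico_same,
    lintegral_slice_Ico_zero_one, lintegral_slice_Ico_one_two, lintegral_slice_Ico_two_three,
    ← ENNReal.ofReal_add (by norm_num) (by norm_num),
    ← ENNReal.ofReal_add (by norm_num) (by norm_num)]
  rw [show (1 / 18 + 1 / 6 + 1 / 12 : ℝ) = 11 / 36 by norm_num,
    ENNReal.ofReal_div_of_pos (by norm_num)]
  norm_num
end
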